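/- arXiv:1212.2522 — 3 statements merged into one kernel-verified Lean document; each statement's English description precedes it below -/
import Mathlib

section
/- Let (B, L) be a Banach SN space with Banach SN dual (B*, L̃), and set Λ := −L̃. Let A be a closed linear L-positive subspace of B such that A⁰ is Λ-positive, let d ∈ B, c* ∈ B*, and η > 0. Then there exists b ∈ A − d such that η‖b‖ ≤ q_Λ(Lb − c*) + 3‖c*‖η + 5η². -/
open NormedSpace

variable {B : Type*} [NormedAddCommGroup B] [NormedSpace ℝ B]

/-- `L : B → B*` is an SN ("symmetric nonexpansive") map: `‖L‖ ≤ 1` and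
`⟨b, Lc⟩ = ⟨c, Lb⟩` for all `b, c ∈ B`. -/
def IsSNMap (L : B →L[ℝ] StrongDual ℝ B) : Prop :=
  ‖L‖ ≤ 1 ∧ ∀ b c : B, L c b = L b c

/-- The quadratic form `q_L(b) := (1/2)⟨b, Lb⟩` of an SN map. -/
noncomputable def qL (L : B →L[ℝ] StrongDual ℝ B) (b : B) : ℝ :=
  (1 / 2) * L b b

/-- `A ⊆ B` is `L`-positive: `A ≠ ∅` and `q_L(b - c) ≥ 0` for all `b, c ∈ A`. -/
def LPos (L : B →L[ℝ] StrongDual ℝ B) (A : Set B) : Prop :=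
  A.Nonempty ∧ ∀ b ∈ A, ∀ c ∈ A, 0 ≤ qL L (b - c)

/-- `A` is maximally `L`-positive: it is `L`-positive and not properly contained in
any other `L`-positive subset of `B`. -/
def MaxLPos (L : B →L[ℝ] StrongDual ℝ B) (A : Set B) : Prop :=
  LPos L A ∧ ∀ C : Set B, LPos L C → A ⊆ C → C = A

/-- The polar subspace `A⁰ := {b* ∈ B* : ⟨a, b*⟩ = 0 for all a ∈ A}`. -/
def polarSet (A : Set B) : Set (StrongDual ℝ B) :=
  {f | ∀ a ∈ A, f a = 0}

/-- `(B*, L')` is a Banach SN dual of `(B, L)`: `L'` is an SN map on `B*` and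
`⟨Lb, L'b*⟩ = ⟨b, b*⟩` for all `b ∈ B`, `b* ∈ B*`. -/
def IsSNDual (L : B →L[ℝ] StrongDual ℝ B) (L' : StrongDual ℝ B →L[ℝ] StrongDual ℝ (StrongDual ℝ B)) : Prop :=
  IsSNMap L' ∧ ∀ (b : B) (b' : StrongDual ℝ B), L' b' (L b) = b' b

open Filter Topology in
/-- A weak form of Ekeland's variational principle: a lower semicontinuous function on a complete
metric space which is bounded below has, up to an `ε`-Lipschitz perturbation, a minimizer. -/
theorem exists_forall_le_add_mul_dist {X : Type*} [MetricSpace X] [CompleteSpace X] [Nonempty X]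
    {F : X → ℝ} (hF : LowerSemicontinuous F) (hbdd : BddBelow (Set.range F)) {ε : ℝ}
    (hε : 0 < ε) : ∃ x, ∀ y, F x ≤ F y + ε * dist x y := by
  let S : X → Set X := fun x => {y | F y + ε * dist x y ≤ F x}
  have hrefl : ∀ x, x ∈ S x := fun x => by simp [S]
  have htrans : ∀ {x y z}, y ∈ S x → z ∈ S y → z ∈ S x := fun {x y z} hy hz => by
    simp only [S, Set.mem_ofPred_eq] at hy hz ⊢
    nlinarith [dist_triangle x y z]
  have hclosed : ∀ x, IsClosed (S x) := fun x =>
    (hF.add (Continuous.lowerSemicontinuous (by fun_prop :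
      Continuous fun y => ε * dist x y))).isClosed_preimage (F x)
  have hstep : ∀ (x : X) (n : ℕ), ∃ z ∈ S x, ∀ y ∈ S x, F z ≤ F y + (1 / 2) ^ n := by
    intro x n
    have hbd : BddBelow (F '' S x) := hbdd.mono (Set.image_subset_range _ _)
    obtain ⟨_, ⟨z, hz, rfl⟩, hlt⟩ := exists_lt_of_csInf_lt (Set.Nonempty.image F ⟨x, hrefl x⟩)
      (lt_add_of_pos_right (sInf (F '' S x)) (by positivity : (0 : ℝ) < (1 / 2) ^ n))
    refine ⟨z, hz, fun y hy => ?_⟩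
    linarith [csInf_le hbd ⟨y, hy, rfl⟩]
  choose g hgS hg using hstep
  obtain ⟨x₀⟩ := ‹Nonempty X›
  let u : ℕ → X := fun n => Nat.rec (g x₀ 0) (fun n x => g x (n + 1)) n
  have hmono : ∀ n m, n ≤ m → u m ∈ S (u n) := by
    intro n m hnm
    induction m, hnm using Nat.le_induction with
    | base => exact hrefl _
    | succ m _ ih => exact htrans ih (hgS (u m) (m + 1))
  have hsmall : ∀ n, ∀ y ∈ S (u n), dist (u n) y ≤ (1 / 2) ^ n / ε := by
    intro n y hy
    have hle : F (u n) ≤ F y + (1 / 2) ^ n := by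
      cases n with
      | zero => exact hg x₀ 0 y (htrans (hgS x₀ 0) hy)
      | succ n => exact hg (u n) (n + 1) y (htrans (hgS (u n) (n + 1)) hy)
    rw [le_div_iff₀ hε]
    simp only [S, Set.mem_ofPred_eq] at hy
    linarith
  have hlim : Tendsto (fun n : ℕ => ((1 : ℝ) / 2) ^ n / ε) atTop (𝓝 0) := by
    simpa using (tendsto_pow_atTop_nhds_zero_of_lt_one (r := (1 : ℝ) / 2) (by norm_num)
      (by norm_num)).div_const ε
  obtain ⟨x, hx⟩ := cauchySeq_tendsto_of_complete
    (cauchySeq_of_le_tendsto_0' _ (fun n m hnm => hsmall n _ (hmono n m hnm)) hlim)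
  have hxS : ∀ n, x ∈ S (u n) := fun n =>
    (hclosed (u n)).mem_of_tendsto hx ((eventually_ge_atTop n).mono fun m hm => hmono n m hm)
  refine ⟨x, fun y => ?_⟩
  by_contra! hlt
  have hy : y ∈ S x := hlt.le
  have hxy : Tendsto u atTop (𝓝 y) := by
    rw [tendsto_iff_dist_tendsto_zero]
    exact squeeze_zero (fun _ => dist_nonneg) (fun n => hsmall n y (htrans (hxS n) hy)) hlim
  rw [tendsto_nhds_unique hx hxy] at hlt
  simp at hlt

/-- A linear functional on a subspace extends to a functional of norm at most `κ` whose value at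
`b` is at most `-r`, as soon as it satisfies the evident necessary condition. -/
theorem exists_extension_norm_le_apply_le (A : Submodule ℝ B) (l : A →ₗ[ℝ] ℝ) (b : B) {κ r : ℝ}
    (hκ : 0 ≤ κ) (h : ∀ a : A, l a + r ≤ κ * ‖(a : B) - b‖) :
    ∃ w : StrongDual ℝ B, (∀ a : A, w a = l a) ∧ ‖w‖ ≤ κ ∧ w b ≤ -r := by
  have hr : r ≤ κ * ‖b‖ := by simpa using h 0
  have hl : ∀ a : A, l a ≤ κ * ‖(a : B)‖ := by
    intro a
    by_contra! hlt
    have hδ : 0 < l a - κ * ‖(a : B)‖ := sub_pos.2 hlt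
    set t : ℝ := (κ * ‖b‖ - r + 1) / (l a - κ * ‖(a : B)‖) with ht
    have ht0 : 0 ≤ t := div_nonneg (by linarith) hδ.le
    have htδ : t * (l a - κ * ‖(a : B)‖) = κ * ‖b‖ - r + 1 := div_mul_cancel₀ _ hδ.ne'
    have h₁ := h (t • a)
    have h₂ : ‖((t • a : A) : B) - b‖ ≤ t * ‖(a : B)‖ + ‖b‖ := by
      refine (norm_sub_le _ _).trans_eq ?_
      rw [Submodule.coe_smul, norm_smul, Real.norm_of_nonneg ht0]
    rw [map_smul, smul_eq_mul] at h₁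
    nlinarith [mul_le_mul_of_nonneg_left h₂ hκ]
  let φ : B → {s : ℝ // 0 ≤ s} → ℝ := fun x s => κ * ‖x - (s : ℝ) • b‖ - s * r
  have hφ : ∀ x s, -(κ * ‖x‖) ≤ φ x s := by
    rintro x ⟨s, hs⟩
    have h₁ : s * ‖b‖ ≤ ‖x‖ + ‖x - s • b‖ := by
      have := norm_sub_le x (x - s • b)
      rwa [sub_sub_cancel, norm_smul, Real.norm_of_nonneg hs] at this
    simp only [φ]
    nlinarith [mul_le_mul_of_nonneg_left h₁ hκ, mul_le_mul_of_nonneg_left hr hs]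
  have hbdd : ∀ x, BddBelow (Set.range (φ x)) := fun x =>
    ⟨-(κ * ‖x‖), by rintro _ ⟨s, rfl⟩; exact hφ x s⟩
  have : Nonempty {s : ℝ // 0 ≤ s} := ⟨⟨0, le_rfl⟩⟩
  have hhom : ∀ c : ℝ, 0 < c → ∀ x, ⨅ s, φ (c • x) s ≤ c * ⨅ s, φ x s := by
    intro c hc x
    rw [Real.mul_iInf_of_nonneg hc.le]
    refine le_ciInf fun s => (ciInf_le (hbdd _) ⟨c * s, mul_nonneg hc.le s.2⟩).trans_eq ?_
    simp only [φ]
    rw [mul_smul, ← smul_sub, norm_smul, Real.norm_of_nonneg hc.le]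
    ring
  obtain ⟨g, hgA, hgN⟩ := exists_extension_of_le_sublinear ⟨A, l⟩ (fun x => ⨅ s, φ x s)
    (fun c hc x => by
      refine (hhom c hc x).antisymm ?_
      have := hhom c⁻¹ (inv_pos.2 hc) (c • x)
      rw [inv_smul_smul₀ hc.ne'] at this
      rwa [le_inv_mul_iff₀ hc] at this)
    (fun x y => by
      refine le_ciInf_add_ciInf fun s t =>
        (ciInf_le (hbdd _) ⟨s + t, add_nonneg s.2 t.2⟩).trans ?_
      have h₁ : ‖x + y - ((s : ℝ) + t) • b‖ ≤ ‖x - (s : ℝ) • b‖ + ‖y - (t : ℝ) • b‖ := by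
        rw [add_smul, add_sub_add_comm]
        exact norm_add_le _ _
      simp only [φ]
      nlinarith [mul_le_mul_of_nonneg_left h₁ hκ])
    (fun a => by
      refine le_ciInf ?_
      rintro ⟨s, hs⟩
      simp only [φ]
      rcases hs.eq_or_lt with rfl | hs
      · simpa using hl a
      · have h₁ := mul_le_mul_of_nonneg_left (h (s⁻¹ • a)) hs.le
        have h₂ : s * ‖((s⁻¹ • a : A) : B) - b‖ = ‖(a : B) - s • b‖ := by
          rw [← Real.norm_of_nonneg hs.le, ← norm_smul, smul_sub, Real.norm_of_nonneg hs.le,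
            Submodule.coe_smul, smul_inv_smul₀ hs.ne']
        rw [map_smul, smul_eq_mul, mul_add, mul_inv_cancel_left₀ hs.ne', mul_left_comm, h₂] at h₁
        exact le_sub_iff_add_le.2 h₁)
  have hg : ∀ x, g x ≤ κ * ‖x‖ := fun x =>
    (hgN x).trans ((ciInf_le (hbdd x) ⟨0, le_rfl⟩).trans_eq (by simp [φ]))
  have hg' : ∀ x, ‖g x‖ ≤ κ * ‖x‖ := fun x => by
    rw [Real.norm_eq_abs, abs_le']
    exact ⟨hg x, by simpa using hg (-x)⟩
  refine ⟨g.mkContinuous κ hg', hgA, g.mkContinuous_norm_le hκ hg', ?_⟩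
  exact (hgN b).trans ((ciInf_le (hbdd b) ⟨1, zero_le_one⟩).trans_eq (by simp [φ]))

open Filter Topology in
/-- First-order consequence of `b` minimizing, along the direction `-a`, a quadratic plus norm terms. -/
theorem le_of_forall_quadratic_add_norm_nonneg {a b : B} {p q η : ℝ} (hη : 0 ≤ η)
    (h : ∀ t : ℝ, 0 < t →
      0 ≤ t ^ 2 * q - t * p + 2 * η * (‖b - t • a‖ - ‖b‖) + η * (t * ‖a‖)) :
    p + η * ‖b‖ ≤ 3 * η * ‖a - b‖ := by
  have hlin : ∀ t : ℝ, 0 < t → t ≤ 1 → p ≤ 2 * η * (‖a - b‖ - ‖b‖) + η * ‖a‖ + t * q := by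
    intro t ht ht1
    have hconv : ‖b - t • a‖ ≤ (1 - t) * ‖b‖ + t * ‖a - b‖ := by
      have : b - t • a = (1 - t) • b - t • (a - b) := by module
      rw [this]
      refine (norm_sub_le _ _).trans_eq ?_
      rw [norm_smul, norm_smul, Real.norm_of_nonneg ht.le, Real.norm_of_nonneg (sub_nonneg.2 ht1)]
    refine le_of_mul_le_mul_left ?_ ht
    nlinarith [h t ht, mul_le_mul_of_nonneg_left hconv hη]
  have hlim : Tendsto (fun t : ℝ => 2 * η * (‖a - b‖ - ‖b‖) + η * ‖a‖ + t * q) (𝓝[>] 0)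
      (𝓝 (2 * η * (‖a - b‖ - ‖b‖) + η * ‖a‖)) := by
    refine tendsto_nhdsWithin_of_tendsto_nhds ?_
    exact (by fun_prop : Continuous fun t : ℝ =>
      2 * η * (‖a - b‖ - ‖b‖) + η * ‖a‖ + t * q).tendsto' _ _ (by simp)
  have hp := ge_of_tendsto hlim <| by
    filter_upwards [Ioc_mem_nhdsGT zero_lt_one] with t ht using hlin t ht.1 ht.2
  have htri : ‖a‖ ≤ ‖a - b‖ + ‖b‖ := norm_le_norm_sub_add a b
  nlinarith [mul_le_mul_of_nonneg_left htri hη]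

/-- Expansion of `q_L` along a line, for a symmetric `L`. -/
theorem IsSNMap.qL_sub_smul {L : B →L[ℝ] StrongDual ℝ B} (hL : IsSNMap L) (b a : B) (t : ℝ) :
    qL L (b - t • a) = qL L b - t * L b a + t ^ 2 * qL L a := by
  simp only [qL, map_sub, map_smul, sub_apply, smul_apply,
    smul_eq_mul]
  rw [hL.2 b a]
  ring

/-- The bilinear form of an SN map is bounded by the product of the norms. -/
theorem IsSNMap.abs_apply_le {L : B →L[ℝ] StrongDual ℝ B} (hL : IsSNMap L) (b c : B) :
    |L b c| ≤ ‖b‖ * ‖c‖ := by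
  refine (L.le_opNorm₂ b c).trans ?_
  have := mul_le_mul_of_nonneg_right hL.1 (norm_nonneg b)
  rw [one_mul] at this
  exact mul_le_mul_of_nonneg_right this (norm_nonneg c)

theorem qL_neg (L : B →L[ℝ] StrongDual ℝ B) (b : B) : qL (-L) b = -qL L b := by
  simp [qL]

theorem IsSNDual.qL_map {L : B →L[ℝ] StrongDual ℝ B}
    {L' : StrongDual ℝ B →L[ℝ] StrongDual ℝ (StrongDual ℝ B)} (h : IsSNDual L L') (b : B) :
    qL L' (L b) = qL L b := by
  rw [qL, qL, h.2]

theorem IsSNDual.qL_map_sub {L : B →L[ℝ] StrongDual ℝ B}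
    {L' : StrongDual ℝ B →L[ℝ] StrongDual ℝ (StrongDual ℝ B)} (h : IsSNDual L L') (b : B)
    (c' : StrongDual ℝ B) : qL L' (L b - c') = qL L b - c' b + qL L' c' := by
  have := h.1.qL_sub_smul (L b) c' 1
  rw [one_smul, h.qL_map, h.1.2 c' (L b), h.2] at this
  linarith

set_option maxSynthPendingDepth 3 in
/-- strengthened Lemma 5.5. Under the hypotheses of Lemma 5.5, there exists
`b ∈ A - d` with `η‖b‖ ≤ q_Λ(Lb - c*) + 3‖c*‖η + 5η²`. -/
theorem exists_in_sub_d_qLambda_bound_norm [CompleteSpace B] [Nontrivial B]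
    (L : B →L[ℝ] StrongDual ℝ B) (L' : StrongDual ℝ B →L[ℝ] StrongDual ℝ (StrongDual ℝ B))
    (hL : IsSNMap L) (hdual : IsSNDual L L')
    (A : Submodule ℝ B) (hAc : IsClosed (A : Set B)) (hApos : LPos L (A : Set B))
    (hpolar : LPos (-L') (polarSet (A : Set B)))
    (d : B) (c' : StrongDual ℝ B) (η : ℝ) (hη : 0 < η) :
    ∃ b : B, b + d ∈ A ∧
      η * ‖b‖ ≤ qL (-L') (L b - c') + 3 * ‖c'‖ * η + 5 * η ^ 2 := by
  have hvalue : ∀ b : B, qL (-L') (L b - c') = c' b - qL L b - qL L' c' := fun b => by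
    rw [qL_neg, hdual.qL_map_sub]
    ring
  simp only [hvalue]
  let F : A → ℝ := fun a => qL L (a - d) - c' (a - d) + 2 * η * ‖(a : B) - d‖
  by_cases hbdd : BddBelow (Set.range F)
  · have hcont : Continuous F := by
      simp only [F, qL]
      fun_prop
    have : CompleteSpace A := hAc.completeSpace_coe
    obtain ⟨x, hx⟩ := exists_forall_le_add_mul_dist hcont.lowerSemicontinuous hbdd hη
    set b : B := x - d with hb
    have hfirst : ∀ a : A, (L b - c') a + η * ‖b‖ ≤ 3 * η * ‖(a : B) - b‖ := by
      intro a
      refine le_of_forall_quadratic_add_norm_nonneg (q := qL L (a : B)) hη.le fun t ht => ?_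
      have h₁ := hx (x - t • a)
      have h₂ : ((x - t • a : A) : B) - d = b - t • (a : B) := by
        simp only [hb, Submodule.coe_sub, Submodule.coe_smul]
        abel
      have h₃ : dist x (x - t • a) = t * ‖(a : B)‖ := by
        rw [dist_eq_norm, sub_sub_cancel, norm_smul, Real.norm_of_nonneg ht.le, Submodule.coe_norm]
      simp only [F] at h₁
      rw [h₂, h₃, ← hb, hL.qL_sub_smul, map_sub c' b, map_smul, smul_eq_mul] at h₁
      rw [sub_apply]
      linarith
    obtain ⟨w, hwA, hwn, hwb⟩ := exists_extension_norm_le_apply_le A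
      ((L b - c').toLinearMap.domRestrict A) b (by positivity) hfirst
    have hmem : L b - (c' + w) ∈ polarSet (A : Set B) := fun a ha => by
      have := hwA ⟨a, ha⟩
      simp only [LinearMap.domRestrict_apply, ContinuousLinearMap.coe_coe,
        sub_apply] at this
      simp only [sub_apply, add_apply]
      linarith
    have hpos := hpolar.2 _ hmem 0 fun a _ => rfl
    have hsplit : qL L' (c' + w) = qL L' c' + L' c' w + qL L' w := by
      have := hdual.1.qL_sub_smul c' w (-1)
      rw [neg_one_smul, sub_neg_eq_add] at this
      linarith
    rw [sub_zero, qL_neg, hdual.qL_map_sub, hsplit, add_apply] at hpos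
    have hcw := abs_le.1 (hdual.1.abs_apply_le c' w)
    have hww := abs_le.1 (hdual.1.abs_apply_le w w)
    have hw2 : qL L' w = 1 / 2 * L' w w := rfl
    refine ⟨b, by simp [hb], ?_⟩
    nlinarith [mul_le_mul_of_nonneg_left hwn (norm_nonneg c'),
      mul_le_mul hwn hwn (norm_nonneg w) (by positivity), sq_nonneg η]
  · obtain ⟨_, ⟨x, rfl⟩, hx⟩ := not_bddBelow_iff.1 hbdd (-qL L' c')
    refine ⟨x - d, by simp, ?_⟩
    simp only [F] at hx
    have h₁ : 0 ≤ η * ‖(x : B) - d‖ := by positivity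
    have h₂ : 0 ≤ 3 * ‖c'‖ * η + 5 * η ^ 2 := by positivity
    linarith
end

section
/- Let (B, L) be a Banach SN space with Banach SN dual (B*, L̃), and set Λ := −L̃. Let A be a closed linear L-positive subspace of B such that A⁰ is Λ-positive, let d ∈ B and η > 0. Then there exists b ∈ A − d such that η · inf_{a ∈ A} ‖a − d‖ + q_L(b) ≤ 5η². -/
open NormedSpace

variable {B : Type*} [NormedAddCommGroup B] [NormedSpace ℝ B]

set_option maxSynthPendingDepth 3

theorem exists_dual_vanishing_eq_dist (A : Submodule ℝ B) (d : B) :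
    ∃ f : StrongDual ℝ B, ‖f‖ ≤ 1 ∧ (∀ a ∈ A, f a = 0) ∧
      f d = sInf ((fun a => ‖a - d‖) '' (A : Set B)) := by
  obtain ⟨g, hg1, hg⟩ := exists_dual_vector'' ℝ (A.mkQ d)
  have hbound : ∀ x, ‖(g.toLinearMap ∘ₗ A.mkQ) x‖ ≤ 1 * ‖x‖ := fun x =>
    (g.le_opNorm (A.mkQ x)).trans
      (mul_le_mul hg1 (Submodule.Quotient.norm_mk_le A x) (norm_nonneg _) zero_le_one)
  refine ⟨(g.toLinearMap ∘ₗ A.mkQ).mkContinuous 1 hbound,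
    LinearMap.mkContinuous_norm_le _ zero_le_one _, fun a ha => ?_, ?_⟩
  · have : A.mkQ a = 0 := by simpa using ha
    simp only [LinearMap.mkContinuous_apply, LinearMap.comp_apply, this, map_zero]
  · refine hg.trans ((quotient_norm_mk_eq A.toAddSubgroup d).trans (congrArg sInf ?_))
    ext r
    constructor
    · rintro ⟨a, ha, rfl⟩
      exact ⟨-a, A.neg_mem ha, (norm_neg _).symm.trans (congrArg norm (by abel))⟩
    · rintro ⟨a, ha, rfl⟩
      exact ⟨-a, A.neg_mem ha, (norm_neg _).symm.trans (congrArg norm (by abel))⟩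

theorem qL_nonneg_of_mem {L : B →L[ℝ] StrongDual ℝ B} {S : Set B} (hS : LPos L S)
    (h0 : (0 : B) ∈ S) {x : B} (hx : x ∈ S) : 0 ≤ qL L x := by
  simpa using hS.2 x hx 0 h0

theorem qL_add_smul {L : B →L[ℝ] StrongDual ℝ B} (hL : IsSNMap L) (b h : B) (t : ℝ) :
    qL L (b + t • h) = qL L b + t * L b h + t ^ 2 * qL L h := by
  simp only [qL, map_add, map_smul, add_apply, smul_apply,
    smul_eq_mul, hL.2 h b]
  ring

theorem two_mul_qL_le_norm_sq {L : B →L[ℝ] StrongDual ℝ B} (hL : IsSNMap L) (b : B) :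
    2 * qL L b ≤ ‖b‖ ^ 2 := by
  have h1 := (le_abs_self _).trans (L.le_opNorm₂ b b)
  have h2 : ‖L‖ * ‖b‖ * ‖b‖ ≤ 1 * ‖b‖ * ‖b‖ := by gcongr; exact hL.1
  unfold qL
  nlinarith

theorem neg_norm_sq_le_two_mul_qL {L : B →L[ℝ] StrongDual ℝ B} (hL : IsSNMap L) (b : B) :
    -‖b‖ ^ 2 ≤ 2 * qL L b := by
  have h1 := (neg_le_abs _).trans (L.le_opNorm₂ b b)
  have h2 : ‖L‖ * ‖b‖ * ‖b‖ ≤ 1 * ‖b‖ * ‖b‖ := by gcongr; exact hL.1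
  unfold qL
  nlinarith

/-- A convex quadratic `t ↦ t² u + t v` that is bounded below has a critical point, and its value
there is at most its value at `1`. -/
theorem exists_radially_stationary {u v K : ℝ} (hu : 0 ≤ u)
    (hK : ∀ t : ℝ, K ≤ t ^ 2 * u + t * v) :
    ∃ t : ℝ, t ^ 2 * u + t * v ≤ u + v ∧ 2 * (t ^ 2 * u) + t * v = 0 := by
  rcases hu.eq_or_lt with rfl | hu
  · have hd := discrim_le_zero (a := 0) (b := v) (c := -K) fun t => by linarith [hK t]
    have hv : v = 0 := by
      unfold discrim at hd
      nlinarith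
    exact ⟨1, by simp, by simp [hv]⟩
  · refine ⟨-v / (2 * u), ?_, by field_simp; ring⟩
    have : u + v - ((-v / (2 * u)) ^ 2 * u + -v / (2 * u) * v) = (2 * u + v) ^ 2 / (4 * u) := by
      field_simp
      ring
    have : 0 ≤ (2 * u + v) ^ 2 / (4 * u) := by positivity
    linarith

/-- If `q_L` is bounded below on the affine subspace `A - d`, there is a point of `A - d` at which
the derivative of `q_L` along `A` is small and vanishes in the radial direction. -/
theorem exists_almost_stationary {L : B →L[ℝ] StrongDual ℝ B} (hL : IsSNMap L)
    (A : Submodule ℝ B) (hpos : ∀ a ∈ A, 0 ≤ qL L a) (d : B) {K : ℝ}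
    (hK : ∀ a ∈ A, K ≤ qL L (a - d)) {ε : ℝ} (hε : 0 < ε) :
    ∃ a ∈ A, L (a - d) a = 0 ∧ ∀ h ∈ A, |L (a - d) h| ≤ ε * ‖h‖ := by
  set S := (fun a => qL L (a - d)) '' (A : Set B) with hS
  have hne : S.Nonempty := ⟨_, 0, A.zero_mem, rfl⟩
  have hbdd : BddBelow S := ⟨K, by rintro _ ⟨a, ha, rfl⟩; exact hK a ha⟩
  have hinf : ∀ a ∈ A, sInf S ≤ qL L (a - d) := fun a ha => csInf_le hbdd ⟨a, ha, rfl⟩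
  obtain ⟨_, ⟨a₀, ha₀, rfl⟩, hlt⟩ :=
    exists_lt_of_csInf_lt hne (lt_add_of_pos_right (sInf S) (by positivity : 0 < ε ^ 2 / 2))
  have hray : ∀ t : ℝ, qL L (t • a₀ - d) = qL L d + (t ^ 2 * qL L a₀ + t * -L d a₀) := fun t => by
    have := qL_add_smul hL (-d) a₀ t
    rw [neg_add_eq_sub] at this
    rw [this]
    simp [qL]
    ring
  obtain ⟨t, htle, ht0⟩ := exists_radially_stationary (v := -L d a₀) (K := sInf S - qL L d)
    (hpos a₀ ha₀) fun t => by
      have := hinf _ (A.smul_mem t ha₀)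
      rw [hray] at this
      linarith
  refine ⟨t • a₀, A.smul_mem t ha₀, ?_, fun h hh => ?_⟩
  · rw [← ht0]
    simp [qL]
    ring
  · have hone := hray 1
    rw [one_smul] at hone
    have hnear : qL L (t • a₀ - d) < sInf S + ε ^ 2 / 2 := by
      rw [hray]
      simp only at hlt
      linarith
    have hd := discrim_le_zero (a := qL L h) (b := L (t • a₀ - d) h) (c := ε ^ 2 / 2) fun s => by
      have h1 := hinf (t • a₀ + s • h) (A.add_mem (A.smul_mem t ha₀) (A.smul_mem s hh))
      rw [add_sub_right_comm, qL_add_smul hL] at h1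
      linarith
    have hq := two_mul_qL_le_norm_sq hL h
    refine abs_le_of_sq_le_sq ?_ (by positivity)
    unfold discrim at hd
    nlinarith [sq_nonneg ε]

/-- Perturbed duality estimate between `q_L` on `A - d` and `q_{L'}` on `A⁰`. -/
theorem exists_qL_sub_add_le {L : B →L[ℝ] StrongDual ℝ B}
    {L' : StrongDual ℝ B →L[ℝ] StrongDual ℝ (StrongDual ℝ B)}
    (hL : IsSNMap L) (hdual : IsSNDual L L') (A : Submodule ℝ B)
    (hpos : ∀ a ∈ A, 0 ≤ qL L a) (hpolar : ∀ f ∈ polarSet (A : Set B), qL L' f ≤ 0) (d : B)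
    {K : ℝ} (hK : ∀ a ∈ A, K ≤ qL L (a - d)) {f : StrongDual ℝ B}
    (hf : f ∈ polarSet (A : Set B)) {ε : ℝ} (hε : 0 < ε) :
    ∃ a ∈ A, qL L (a - d) - f d ≤ (‖f‖ + ε) ^ 2 / 2 + ε * ‖d‖ := by
  obtain ⟨a, ha, hrad, hder⟩ := exists_almost_stationary hL A hpos d hK hε
  obtain ⟨e, he, hnorm⟩ := exists_extension_norm_eq A ((L (a - d)).comp A.subtypeL)
  have hnorm_e : ‖e‖ ≤ ε := hnorm.trans_le
    (ContinuousLinearMap.opNorm_le_bound _ hε.le fun h => hder h h.2)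
  have hea : e a = 0 := (he ⟨a, ha⟩).trans hrad
  refine ⟨a, ha, ?_⟩
  have hc := hpolar (f - e + (1 : ℝ) • L (a - d)) fun h hh => by
    have h1 : e h = L (a - d) h := he ⟨h, hh⟩
    have h2 := hf h hh
    simp [h1, h2]
  rw [qL_add_smul hdual.1, hdual.2] at hc
  have hqL : qL L' (L (a - d)) = qL L (a - d) := by
    unfold qL
    rw [hdual.2]
  have hfa := hf a ha
  have heval : (f - e) (a - d) = -f d + e d := by
    simp only [sub_apply, map_sub, hfa, hea]
    ring
  rw [hqL, heval] at hc
  have hed : -e d ≤ ε * ‖d‖ :=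
    ((neg_le_abs _).trans (e.le_opNorm d)).trans (by gcongr)
  have hlow := neg_norm_sq_le_two_mul_qL hdual.1 (f - e)
  have hfe : ‖f - e‖ ^ 2 ≤ (‖f‖ + ε) ^ 2 := by
    gcongr
    exact (norm_sub_le f e).trans (by gcongr)
  linarith

/-- Corollary 5.6. Let `A` be a closed linear `L`-positive subspace of `B`
with `A⁰` `Λ`-positive, `d ∈ B` and `η > 0`.  Then there exists `b ∈ A - d` such that
`η·inf_{a ∈ A} ‖a - d‖ + q_L(b) ≤ 5η²`. -/
theorem exists_in_sub_d_qL_bound [CompleteSpace B] [Nontrivial B]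
    (L : B →L[ℝ] StrongDual ℝ B) (L' : StrongDual ℝ B →L[ℝ] StrongDual ℝ (StrongDual ℝ B))
    (hL : IsSNMap L) (hdual : IsSNDual L L')
    (A : Submodule ℝ B) (hAc : IsClosed (A : Set B)) (hApos : LPos L (A : Set B))
    (hpolar : LPos (-L') (polarSet (A : Set B)))
    (d : B) (η : ℝ) (hη : 0 < η) :
    ∃ b : B, b + d ∈ A ∧
      η * sInf ((fun a => ‖a - d‖) '' (A : Set B)) + qL L b ≤ 5 * η ^ 2 := by
  obtain ⟨f, hf1, hfA, hfd⟩ := exists_dual_vanishing_eq_dist A d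
  have hpos : ∀ a ∈ A, 0 ≤ qL L a := fun a ha => qL_nonneg_of_mem hApos A.zero_mem ha
  have hneg : ∀ g ∈ polarSet (A : Set B), qL L' g ≤ 0 := fun g hg => by
    have := qL_nonneg_of_mem hpolar (fun _ _ => rfl) hg
    simp only [qL, neg_apply] at this ⊢
    linarith
  rw [← hfd]
  by_contra! hcon
  have hlow : ∀ a ∈ A, 5 * η ^ 2 - η * f d < qL L (a - d) := fun a ha => by
    have := hcon (a - d) (by simpa using ha)
    linarith
  have hnorm : ‖-(η • f)‖ ≤ η := by
    rw [norm_neg, norm_smul, Real.norm_of_nonneg hη.le]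
    nlinarith
  obtain ⟨a, ha, hle⟩ := exists_qL_sub_add_le hL hdual A hpos hneg d
    (fun a ha => (hlow a ha).le) (f := -(η • f)) (fun a ha => by simp [hfA a ha])
    (ε := min η (η ^ 2 / (‖d‖ + 1))) (by positivity)
  have hεd : min η (η ^ 2 / (‖d‖ + 1)) * ‖d‖ ≤ η ^ 2 :=
    calc min η (η ^ 2 / (‖d‖ + 1)) * ‖d‖ ≤ η ^ 2 / (‖d‖ + 1) * (‖d‖ + 1) := by
          gcongr
          · exact min_le_right _ _
          · linarith
      _ = η ^ 2 := by field_simp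
  have hsq : (‖-(η • f)‖ + min η (η ^ 2 / (‖d‖ + 1))) ^ 2 ≤ (η + η) ^ 2 := by
    gcongr
    exact min_le_left _ _
  have := hlow a ha
  simp only [neg_apply, smul_apply, smul_eq_mul] at hle
  nlinarith [sq_pos_of_pos hη]
end

section
/- Let (B, L) be a Banach SN space with Banach SN dual (B*, L̃), and set Λ := −L̃. Let A be a closed linear L-positive subspace of B such that A⁰ is Λ-positive. Then A⁰ is maximally Λ-positive. -/
open NormedSpace

variable {B : Type*} [NormedAddCommGroup B] [NormedSpace ℝ B]

set_option maxSynthPendingDepth 3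

lemma abs_qL_le {L : B →L[ℝ] StrongDual ℝ B} (hL : IsSNMap L) (b : B) :
    |qL L b| ≤ (1 / 2) * ‖b‖ ^ 2 := by
  have h : ‖L b b‖ ≤ ‖L‖ * ‖b‖ * ‖b‖ := L.le_opNorm₂ b b
  have h' : ‖L‖ * ‖b‖ * ‖b‖ ≤ 1 * ‖b‖ * ‖b‖ := by gcongr; exact hL.1
  rw [Real.norm_eq_abs] at h
  rw [qL, abs_mul, abs_of_pos (by norm_num : (0 : ℝ) < 1 / 2)]
  linarith

lemma qL_add {L : B →L[ℝ] StrongDual ℝ B} (hL : IsSNMap L) (b c : B) :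
    qL L (b + c) = qL L b + L b c + qL L c := by
  simp only [qL, map_add, add_apply, hL.2 b c]
  ring

lemma LPos.qL_nonneg {L : B →L[ℝ] StrongDual ℝ B} {A : Submodule ℝ B}
    (hA : LPos L (A : Set B)) {x : B} (hx : x ∈ A) : 0 ≤ qL L x := by
  simpa using hA.2 x hx 0 A.zero_mem

lemma IsSNDual.qL_map_add {L : B →L[ℝ] StrongDual ℝ B}
    {L' : StrongDual ℝ B →L[ℝ] StrongDual ℝ (StrongDual ℝ B)} (hdual : IsSNDual L L')
    (b : B) (s : StrongDual ℝ B) : qL L' (L b + s) = qL L b + s b + qL L' s := by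
  rw [qL_add hdual.1, ← hdual.1.2 (L b) s, hdual.2]
  simp only [qL, hdual.2]

/-- The functional `q_L(x) + ‖x‖² / 2 - ⟨x, c⟩`, a proximal regularization of `q_L`. -/
noncomputable def proxFun (L : B →L[ℝ] StrongDual ℝ B) (c : StrongDual ℝ B) (x : B) : ℝ :=
  qL L x + (1 / 2) * ‖x‖ ^ 2 - c x

lemma exists_proxFun_le_add {L : B →L[ℝ] StrongDual ℝ B} (c : StrongDual ℝ B)
    {A : Submodule ℝ B} (hA : LPos L (A : Set B)) {η : ℝ} (hη : 0 < η) :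
    ∃ a ∈ A, ∀ x ∈ A, proxFun L c a ≤ proxFun L c x + η := by
  have hbdd : BddBelow (Set.range fun x : A => proxFun L c x) := by
    refine ⟨-(1 / 2) * ‖c‖ ^ 2, ?_⟩
    rintro _ ⟨x, rfl⟩
    have h₁ := hA.qL_nonneg x.2
    have h₂ := (le_abs_self _).trans (c.le_opNorm (x : B))
    simp only [proxFun]
    nlinarith [sq_nonneg (‖c‖ - ‖(x : B)‖)]
  obtain ⟨a, ha⟩ := exists_lt_of_ciInf_lt
    (lt_add_of_pos_right (⨅ x : A, proxFun L c x) hη)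
  refine ⟨a, a.2, fun x hx => ?_⟩
  have := ciInf_le hbdd ⟨x, hx⟩
  simp only at this
  linarith

section ApproximateMinimizer

variable {L : B →L[ℝ] StrongDual ℝ B} {c : StrongDual ℝ B} {A : Submodule ℝ B} {a : B} {δ : ℝ}

lemma sub_apply_le_of_proxFun_le (hL : IsSNMap L) (ha : a ∈ A)
    (hmin : ∀ x ∈ A, proxFun L c a ≤ proxFun L c x + δ ^ 2) {x : B} (hx : x ∈ A) :
    (c - L a) x ≤ (1 / 2) * ‖a + x‖ ^ 2 - (1 / 2) * ‖a‖ ^ 2 + (1 / 2) * ‖x‖ ^ 2 + δ ^ 2 := by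
  have h := hmin (a + x) (A.add_mem ha hx)
  have hq := (le_abs_self _).trans (abs_qL_le hL x)
  simp only [proxFun, qL_add hL, map_add] at h
  simp only [sub_apply]
  linarith

lemma sub_apply_le_mul_norm (hL : IsSNMap L) (ha : a ∈ A) (hδ : 0 < δ)
    (hmin : ∀ x ∈ A, proxFun L c a ≤ proxFun L c x + δ ^ 2) {x : B} (hx : x ∈ A) :
    (c - L a) x ≤ (‖a‖ + 2 * δ) * ‖x‖ := by
  rcases eq_or_ne x 0 with rfl | hx0
  · simp
  have hn : 0 < ‖x‖ := norm_pos_iff.mpr hx0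
  have hy : ‖(δ / ‖x‖) • x‖ = δ := by
    rw [norm_smul, Real.norm_of_nonneg (by positivity)]
    field_simp
  have h := sub_apply_le_of_proxFun_le hL ha hmin (A.smul_mem (δ / ‖x‖) hx)
  have hs : ‖a + (δ / ‖x‖) • x‖ ^ 2 ≤ (‖a‖ + δ) ^ 2 := by
    gcongr
    exact (norm_add_le _ _).trans_eq (by rw [hy])
  rw [hy, map_smul, smul_eq_mul] at h
  have h' : δ / ‖x‖ * (c - L a) x ≤ δ * (‖a‖ + 2 * δ) := by linarith
  rw [div_mul_eq_mul_div, div_le_iff₀ hn, mul_assoc] at h'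
  exact le_of_mul_le_mul_left h' hδ

lemma le_sub_apply_self (hL : IsSNMap L) (ha : a ∈ A) (hδ : 0 < δ) (hδ1 : δ ≤ 1)
    (hmin : ∀ x ∈ A, proxFun L c a ≤ proxFun L c x + δ ^ 2) :
    (1 - δ) * ‖a‖ ^ 2 - δ ≤ (c - L a) a := by
  have h := sub_apply_le_of_proxFun_le hL ha hmin (A.smul_mem (-δ) ha)
  have h₁ : ‖a + (-δ) • a‖ = (1 - δ) * ‖a‖ := by
    rw [show a + (-δ) • a = (1 - δ) • a by module, norm_smul,
      Real.norm_of_nonneg (by linarith)]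
  have h₂ : ‖(-δ) • a‖ = δ * ‖a‖ := by
    rw [norm_smul, norm_neg, Real.norm_of_nonneg hδ.le]
  rw [h₁, h₂, map_smul, smul_eq_mul] at h
  refine le_of_mul_le_mul_left ?_ hδ
  linarith

lemma exists_extension_sub (hL : IsSNMap L) (ha : a ∈ A) (hδ : 0 < δ)
    (hmin : ∀ x ∈ A, proxFun L c a ≤ proxFun L c x + δ ^ 2) :
    ∃ s : StrongDual ℝ B, ‖s‖ ≤ ‖a‖ + 2 * δ ∧ ∀ x ∈ A, s x = (c - L a) x := by
  obtain ⟨s, hs, hnorm⟩ := exists_extension_norm_eq A ((c - L a).comp A.subtypeL)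
  refine ⟨s, hnorm.trans_le ?_, fun x hx => hs ⟨x, hx⟩⟩
  refine ContinuousLinearMap.opNorm_le_bound _ (by positivity) fun x => ?_
  refine abs_le'.mpr ⟨sub_apply_le_mul_norm hL ha hδ hmin x.2, ?_⟩
  have := sub_apply_le_mul_norm hL ha hδ hmin (A.neg_mem x.2)
  rwa [map_neg, norm_neg] at this

lemma norm_sq_le_of_proxFun_le {L' : StrongDual ℝ B →L[ℝ] StrongDual ℝ (StrongDual ℝ B)}
    (hL : IsSNMap L) (hdual : IsSNDual L L') (hA : LPos L (A : Set B))
    (hc : ∀ f ∈ polarSet (A : Set B), qL L' (c - f) ≤ 0)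
    (ha : a ∈ A) (hδ : 0 < δ) (hδ1 : δ ≤ 1 / 8)
    (hmin : ∀ x ∈ A, proxFun L c a ≤ proxFun L c x + δ ^ 2) :
    ‖a‖ ^ 2 ≤ 16 * δ := by
  obtain ⟨s, hs, hsA⟩ := exists_extension_sub hL ha hδ hmin
  have h := hc (c - L a - s) fun x hx => by
    rw [sub_apply, hsA x hx, sub_self]
  rw [show c - (c - L a - s) = L a + s by abel, hdual.qL_map_add, hsA a ha] at h
  have h₁ := hA.qL_nonneg ha
  have h₂ := le_sub_apply_self hL ha hδ (by linarith) hmin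
  have h₃ := (abs_le.mp (abs_qL_le hdual.1 s)).1
  have h₄ : ‖s‖ ^ 2 ≤ (‖a‖ + 2 * δ) ^ 2 := by gcongr
  have h₅ : (1 / 2) * ‖a‖ ^ 2 ≤ δ * (‖a‖ ^ 2 + 2 * ‖a‖ + 1 + 2 * δ) := by linarith
  have h₆ : δ * (‖a‖ ^ 2 + 2 * ‖a‖ + 1 + 2 * δ) ≤ δ * (2 * ‖a‖ ^ 2 + 4) := by
    refine mul_le_mul_of_nonneg_left ?_ hδ.le
    nlinarith [sq_nonneg (‖a‖ - 1)]
  have h₇ : δ * ‖a‖ ^ 2 ≤ 1 / 8 * ‖a‖ ^ 2 := by gcongr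
  linarith

end ApproximateMinimizer

lemma proxFun_nonneg {L : B →L[ℝ] StrongDual ℝ B}
    {L' : StrongDual ℝ B →L[ℝ] StrongDual ℝ (StrongDual ℝ B)} {c : StrongDual ℝ B}
    {A : Submodule ℝ B} (hL : IsSNMap L) (hdual : IsSNDual L L') (hA : LPos L (A : Set B))
    (hc : ∀ f ∈ polarSet (A : Set B), qL L' (c - f) ≤ 0) {x : B} (hx : x ∈ A) :
    0 ≤ proxFun L c x := by
  have key : ∀ ε : ℝ, 0 < ε → ε ≤ 1 / 8 → -(ε * (4 * ‖c‖ + 1)) ≤ proxFun L c x := by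
    intro ε hε hε1
    obtain ⟨a, ha, hmin⟩ := exists_proxFun_le_add c hA (show 0 < (ε ^ 2) ^ 2 by positivity)
    have hsq := norm_sq_le_of_proxFun_le hL hdual hA hc ha (by positivity)
      (by nlinarith) hmin
    have hn : ‖a‖ ≤ 4 * ε := by
      refine le_of_sq_le_sq ?_ (by positivity)
      linarith
    have h₁ := hA.qL_nonneg ha
    have h₂ := (le_abs_self _).trans (c.le_opNorm a)
    have h₃ : ‖c‖ * ‖a‖ ≤ ‖c‖ * (4 * ε) := by gcongr
    have h₄ := hmin x hx
    have h₅ : (ε ^ 2) ^ 2 ≤ ε := by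
      rw [← pow_mul]
      exact pow_le_of_le_one hε.le (by linarith) (by norm_num)
    have h₆ : -(c a) - (ε ^ 2) ^ 2 ≤ proxFun L c x := by
      have : -(c a) ≤ proxFun L c a := by
        have := sq_nonneg ‖a‖
        simp only [proxFun]
        linarith
      linarith
    linarith
  by_contra! hneg
  set p := -proxFun L c x with hp
  have hp0 : 0 < p := by linarith
  have hM : 0 < 4 * ‖c‖ + 1 := by positivity
  have h := key (min (1 / 8) (p / (2 * (4 * ‖c‖ + 1)))) (by positivity) (min_le_left _ _)
  have h' : min (1 / 8) (p / (2 * (4 * ‖c‖ + 1))) * (4 * ‖c‖ + 1) ≤ p / 2 :=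
    (mul_le_mul_of_nonneg_right (min_le_right _ _) hM.le).trans_eq (by field_simp)
  linarith

lemma mem_polarSet_of_qL_sub_nonpos {L : B →L[ℝ] StrongDual ℝ B}
    {L' : StrongDual ℝ B →L[ℝ] StrongDual ℝ (StrongDual ℝ B)} {c : StrongDual ℝ B}
    {A : Submodule ℝ B} (hL : IsSNMap L) (hdual : IsSNDual L L') (hA : LPos L (A : Set B))
    (hc : ∀ f ∈ polarSet (A : Set B), qL L' (c - f) ≤ 0) : c ∈ polarSet (A : Set B) := by
  have hquad : ∀ x ∈ A, c x ≤ ‖x‖ ^ 2 := fun x hx => by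
    have h := proxFun_nonneg hL hdual hA hc hx
    have hq := (le_abs_self _).trans (abs_qL_le hL x)
    simp only [proxFun] at h
    linarith
  intro x hx
  have hscale : ∀ t : ℝ, 0 ≤ ‖x‖ ^ 2 * (t * t) + -(c x) * t + 0 := fun t => by
    have h := hquad (t • x) (A.smul_mem t hx)
    rw [map_smul, smul_eq_mul, norm_smul, mul_pow, Real.norm_eq_abs, sq_abs] at h
    linarith
  have h := discrim_le_zero hscale
  simp only [discrim] at h
  nlinarith [sq_nonneg (c x)]

/-- Theorem 5.9(b). Let `A` be a closed linear `L`-positive subspace of `B`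
with `A⁰` `Λ`-positive (`Λ := -L'`).  Then `A⁰` is maximally `Λ`-positive. -/
theorem polar_maxLambdaPos_of_polar_LambdaPos [CompleteSpace B] [Nontrivial B]
    (L : B →L[ℝ] StrongDual ℝ B) (L' : StrongDual ℝ B →L[ℝ] StrongDual ℝ (StrongDual ℝ B))
    (hL : IsSNMap L) (hdual : IsSNDual L L')
    (A : Submodule ℝ B) (hAc : IsClosed (A : Set B)) (hApos : LPos L (A : Set B))
    (hpolar : LPos (-L') (polarSet (A : Set B))) :
    MaxLPos (-L') (polarSet (A : Set B)) := by
  refine ⟨hpolar, fun C hC hAC => Set.Subset.antisymm (fun c hc => ?_) hAC⟩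
  refine mem_polarSet_of_qL_sub_nonpos hL hdual hApos fun f hf => ?_
  have h := hC.2 c hc f (hAC hf)
  simp only [qL, neg_apply] at h ⊢
  linarith
end
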